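/- Let $q$ be a prime power, let $n,k,s$ be non-negative integers with $2\le k\le n-2$ and $\gcd(s,n)=1$, and regard the $q$-polynomials $\sum_{i=0}^{n-1}a_ix^{q^i}$ over $\mathbb F_{q^n}$, taken modulo $x^{q^n}-x$, as $\mathbb F_q$-linear maps of $\mathbb F_{q^n}$. Let $\eta\in\mathbb F_{q^n}$ with $\eta\ne 0$ and $\mathrm N_{q^n/q}(\eta)\ne(-1)^{nk}$, and let $$\mathcal H_{k,s}(\eta)=\langle x+\eta x^{q^{sk}},\,x^{q^s},\,\ldots,\,x^{q^{s(k-1)}}\rangle_{\mathbb F_{q^n}}$$ be the corresponding generalized twisted Gabidulin code. Let $\mathcal C$ be an $\mathbb F_{q^n}$-linear MRD code of dimension $k$, that is, a $k$-dimensional $\mathbb F_{q^n}$-subspace of the space of $q$-polynomials in which every nonzero element has rank at least $n-k+1$. Suppose that $\mathcal C$ is equivalent to $\mathcal H_{k,s}(\eta)$, that is, $\mathcal H_{k,s}(\eta)=\{h\circ f^\sigma\circ g : f\in\mathcal C\}$ for some invertible $q$-polynomials $h,g$ and some automorphism $\sigma$ of $\mathbb F_{q^n}$ (acting on the coefficients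 of $f$). Then $$\dim_{\mathbb F_{q^n}}\bigl(\mathcal C\cap\mathcal C^{[s]}\bigr)=k-2,$$ where $\mathcal C^{[s]}=\{f^{[s]} : f\in\mathcal C\}$ and $f^{[s]}=f(x)^{q^s}$, that is, $f^{[s]}=\sum_i a_i^{q^s}x^{q^{i+s}}$ (exponents $i+s$ modulo $n$) for $f=\sum_i a_ix^{q^i}$. -/

import Mathlib

/-! `q`-polynomials `∑ aᵢ x^(q^i)` (`0 ≤ i < n`) over `F = F_{q^n}`, where `q = |Fq|`, represented
by their coefficient vectors `a : Fin n → F`, and regarded as `Fq`-linear maps of `F`. -/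

section QPolyDefs

variable (Fq : Type*) [Field Fq] [Fintype Fq] {F : Type*} [Field F]

/-- The `i`-th power of the Frobenius automorphism of `F` over `Fq` is `x ↦ x^(q^i)`. -/
theorem frobeniusAlgHom_pow_apply [Algebra Fq F] (i : ℕ) (x : F) :
    ((FiniteField.frobeniusAlgHom Fq F) ^ i) x = x ^ (Fintype.card Fq) ^ i := by
  induction i with
  | zero => simp
  | succ i ih => rw [pow_succ', AlgHom.mul_apply, ih, FiniteField.frobeniusAlgHom_apply,
      ← pow_mul, pow_succ]

/-- The `Fq`-linear map `x ↦ ∑ aᵢ x^(q^i)` of `F` given by the `q`-polynomial `a`. -/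
def qmap [Algebra Fq F] {n : ℕ} (a : Fin n → F) : F →ₗ[Fq] F where
  toFun x := ∑ i : Fin n, a i * x ^ (Fintype.card Fq) ^ (i : ℕ)
  map_add' x y := by
    rw [← Finset.sum_add_distrib]
    refine Finset.sum_congr rfl fun i _ => ?_
    have h := map_add ((FiniteField.frobeniusAlgHom Fq F) ^ (i : ℕ)) x y
    simp only [frobeniusAlgHom_pow_apply] at h
    rw [h, mul_add]
  map_smul' c x := by
    rw [RingHom.id_apply, Finset.smul_sum]
    refine Finset.sum_congr rfl fun i _ => ?_
    have h := map_smul ((FiniteField.frobeniusAlgHom Fq F) ^ (i : ℕ)) c x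
    simp only [frobeniusAlgHom_pow_apply] at h
    rw [h, mul_smul_comm]

/-- The rank of a `q`-polynomial: the rank over `Fq` of the corresponding linear map. -/
noncomputable def qrank [Algebra Fq F] {n : ℕ} (a : Fin n → F) : ℕ :=
  Module.finrank Fq (LinearMap.range (qmap Fq a))

/-- The monomial `c x^(q^m)`, reduced modulo `x^(q^n) - x`, so that `m` is taken modulo `n`. -/
def qmonomial (n m : ℕ) (c : F) : Fin n → F :=
  fun j => if (j : ℕ) = m % n then c else 0

/-- Composition of `q`-polynomials, modulo `x^(q^n) - x`:
`(∑ aᵢ x^(q^i)) ∘ (∑ bⱼ x^(q^j)) = ∑ aᵢ bⱼ^(q^i) x^(q^(i+j))`. -/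
def qcomp {n : ℕ} (a b : Fin n → F) : Fin n → F :=
  ∑ i : Fin n, ∑ j : Fin n,
    qmonomial n ((i : ℕ) + (j : ℕ)) (a i * b j ^ (Fintype.card Fq) ^ (i : ℕ))

/-- The power `f^{[s]} = f^(q^s)`, modulo `x^(q^n) - x`:
`(∑ aᵢ x^(q^i))^(q^s) = ∑ aᵢ^(q^s) x^(q^(i+s))`. -/
def qpower {n : ℕ} (s : ℕ) (a : Fin n → F) : Fin n → F :=
  ∑ i : Fin n, qmonomial n ((i : ℕ) + s) (a i ^ (Fintype.card Fq) ^ s)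

/-- The code `C^{[s]} = {f^{[s]} : f ∈ C}` of an `F`-linear code `C`; it is again `F`-linear. -/
def powerCode [Finite F] [Algebra Fq F] {n : ℕ} (s : ℕ) (C : Submodule F (Fin n → F)) :
    Submodule F (Fin n → F) where
  carrier := qpower Fq s '' (C : Set (Fin n → F))
  zero_mem' := by
    refine ⟨0, C.zero_mem, ?_⟩
    ext j
    simp [qpower, qmonomial, Fintype.card_ne_zero]
  add_mem' := by
    rintro _ _ ⟨a, ha, rfl⟩ ⟨b, hb, rfl⟩
    refine ⟨a + b, C.add_mem ha hb, ?_⟩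
    ext j
    simp only [qpower, qmonomial, Finset.sum_apply, Pi.add_apply, ← Finset.sum_add_distrib]
    refine Finset.sum_congr rfl fun i _ => ?_
    have h := map_add ((FiniteField.frobeniusAlgHom Fq F) ^ s) (a i) (b i)
    simp only [frobeniusAlgHom_pow_apply] at h
    split_ifs <;> simp [h]
  smul_mem' := by
    rintro c _ ⟨a, ha, rfl⟩
    have hinj : Function.Injective ((FiniteField.frobeniusAlgHom Fq F) ^ s) := RingHom.injective _
    obtain ⟨d, hd⟩ := (Finite.injective_iff_surjective.mp hinj) c
    simp only [frobeniusAlgHom_pow_apply] at hd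
    refine ⟨d • a, C.smul_mem d ha, ?_⟩
    ext j
    simp only [qpower, qmonomial, Finset.sum_apply, Pi.smul_apply, smul_eq_mul, mul_pow, hd,
      Finset.mul_sum, mul_ite, mul_zero]

/-- Equivalence of codes of `q`-polynomials: `C' = {h ∘ f^σ ∘ g : f ∈ C}` for invertible
`q`-polynomials `h, g` and a field automorphism `σ`, acting on the coefficients of `f`. -/
def CodeEquiv [Algebra Fq F] {n : ℕ} (C C' : Set (Fin n → F)) : Prop :=
  ∃ (h g : Fin n → F) (σ : F ≃+* F),
    Function.Bijective (qmap Fq h) ∧ Function.Bijective (qmap Fq g) ∧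
    C' = (fun f => qcomp Fq h (qcomp Fq (fun i => σ (f i)) g)) '' C

/-- `C` is an `F`-linear MRD code of dimension `k`: a `k`-dimensional `F`-subspace of the
`q`-polynomials all of whose nonzero elements have rank at least `n - k + 1`. -/
def IsLinearMRD [Algebra Fq F] {n : ℕ} (k : ℕ) (C : Submodule F (Fin n → F)) : Prop :=
  Module.finrank F C = k ∧ ∀ f ∈ C, f ≠ 0 → n + 1 ≤ qrank Fq f + k

/-- The code
`H_{k,s}(η) = ⟨x + η x^(q^(sk)), x^(q^s), x^(q^(2s)), …, x^(q^(s(k-1)))⟩` over `F = F_{q^n}`. -/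
def twistedGabidulin (n k s : ℕ) (η : F) : Submodule F (Fin n → F) :=
  Submodule.span F
    ({qmonomial n 0 1 + qmonomial n (s * k) η} ∪
      {f | ∃ i : ℕ, 1 ≤ i ∧ i < k ∧ f = qmonomial n (s * i) 1})

end QPolyDefs

section QPolyAlgebra

variable (Fq : Type*) [Field Fq] [Fintype Fq] {F : Type*} [Field F] [Algebra Fq F]

theorem qmap_apply {n : ℕ} (a : Fin n → F) (x : F) :
    qmap Fq a x = ∑ i : Fin n, a i * x ^ (Fintype.card Fq) ^ (i : ℕ) := rfl

theorem qmap_add {n : ℕ} (a b : Fin n → F) : qmap Fq (a + b) = qmap Fq a + qmap Fq b := by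
  ext x
  simp [qmap_apply, add_mul, Finset.sum_add_distrib]

theorem qmap_smul_apply {n : ℕ} (c : F) (a : Fin n → F) (x : F) :
    qmap Fq (c • a) x = c * qmap Fq a x := by
  simp [qmap_apply, Finset.mul_sum, mul_assoc]

theorem qmap_sum_apply {n : ℕ} {ι : Type*} (t : Finset ι) (a : ι → Fin n → F) (x : F) :
    qmap Fq (∑ i ∈ t, a i) x = ∑ i ∈ t, qmap Fq (a i) x := by
  simp only [qmap_apply, Finset.sum_apply, Finset.sum_mul]
  exact Finset.sum_comm

theorem sum_pow_card_pow {ι : Type*} (t : Finset ι) (i : ℕ) (x : ι → F) :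
    (∑ j ∈ t, x j) ^ (Fintype.card Fq) ^ i = ∑ j ∈ t, x j ^ (Fintype.card Fq) ^ i := by
  simpa only [frobeniusAlgHom_pow_apply] using
    map_sum ((FiniteField.frobeniusAlgHom Fq F) ^ i) x t

/-- Applying a field automorphism `σ` to the coefficients amounts to conjugation by `σ`. -/
theorem qmap_map_apply {n : ℕ} (σ : F ≃+* F) (a : Fin n → F) (x : F) :
    qmap Fq (fun i => σ (a i)) x = σ (qmap Fq a (σ.symm x)) := by
  simp [qmap_apply, map_sum, map_mul, map_pow]

variable [Finite F]

theorem pow_card_pow_finrank (x : F) : x ^ (Fintype.card Fq) ^ Module.finrank Fq F = x := by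
  have := Fintype.ofFinite F
  rw [← Module.card_eq_pow_finrank (K := Fq) (V := F), FiniteField.pow_card]

theorem pow_card_pow_mod {n : ℕ} (hn : Module.finrank Fq F = n) (m : ℕ) (x : F) :
    x ^ (Fintype.card Fq) ^ (m % n) = x ^ (Fintype.card Fq) ^ m := by
  have key : (FiniteField.frobeniusAlgHom Fq F) ^ n = 1 := by
    ext y
    rw [frobeniusAlgHom_pow_apply, ← hn, pow_card_pow_finrank, AlgHom.one_apply]
  rw [← frobeniusAlgHom_pow_apply, ← frobeniusAlgHom_pow_apply, ← pow_eq_pow_mod m key]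

theorem qmap_qmonomial {n : ℕ} (hn : Module.finrank Fq F = n) (m : ℕ) (c x : F) :
    qmap Fq (qmonomial n m c) x = c * x ^ (Fintype.card Fq) ^ m := by
  have hpos : 0 < n := hn ▸ Module.finrank_pos
  rw [qmap_apply, Finset.sum_eq_single ⟨m % n, Nat.mod_lt _ hpos⟩]
  · simp [qmonomial, pow_card_pow_mod Fq hn]
  · intro i _ hi
    rw [qmonomial, if_neg (fun h => hi (Fin.ext h)), zero_mul]
  · simp

theorem qmap_injective {n : ℕ} (hn : Module.finrank Fq F = n) :
    Function.Injective (qmap Fq : (Fin n → F) → F →ₗ[Fq] F) := by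
  subst hn
  have hli := (linearIndependent_algHom_toLinearMap Fq F F).comp _
    (FiniteField.bijective_frobeniusAlgHom_pow Fq F).1
  rw [Fintype.linearIndependent_iff] at hli
  intro a b hab
  ext i
  rw [← sub_eq_zero]
  refine hli (fun j => a j - b j) ?_ i
  ext x
  have hx := LinearMap.congr_fun hab x
  rw [qmap_apply, qmap_apply, ← sub_eq_zero, ← Finset.sum_sub_distrib] at hx
  simpa [LinearMap.sum_apply, frobeniusAlgHom_pow_apply, sub_mul] using hx

theorem qmap_bijective {n : ℕ} (hn : Module.finrank Fq F = n) :
    Function.Bijective (qmap Fq : (Fin n → F) → F →ₗ[Fq] F) := by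
  have : Finite (F →ₗ[Fq] F) := Finite.of_injective _ DFunLike.coe_injective
  refine (qmap_injective Fq hn).bijective_of_nat_card_le ?_
  rw [Module.natCard_eq_pow_finrank (K := Fq) (V := F →ₗ[Fq] F), Module.finrank_linearMap, hn,
    pow_mul, Nat.card_fun, Nat.card_fin, Module.natCard_eq_pow_finrank (K := Fq) (V := F), hn]

theorem qmap_qcomp {n : ℕ} (hn : Module.finrank Fq F = n) (a b : Fin n → F) (x : F) :
    qmap Fq (qcomp Fq a b) x = qmap Fq a (qmap Fq b x) := by
  simp only [qcomp, qmap_sum_apply, qmap_qmonomial Fq hn]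
  rw [qmap_apply Fq a]
  refine Finset.sum_congr rfl fun i _ => ?_
  rw [qmap_apply, sum_pow_card_pow, Finset.mul_sum]
  refine Finset.sum_congr rfl fun j _ => ?_
  rw [mul_pow, ← pow_mul, ← pow_add, mul_assoc, add_comm]

theorem qmap_qpower {n : ℕ} (hn : Module.finrank Fq F = n) (s : ℕ) (a : Fin n → F) (x : F) :
    qmap Fq (qpower Fq s a) x = qmap Fq a x ^ (Fintype.card Fq) ^ s := by
  simp only [qpower, qmap_sum_apply, qmap_qmonomial Fq hn]
  rw [qmap_apply Fq a, sum_pow_card_pow]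
  refine Finset.sum_congr rfl fun i _ => ?_
  rw [mul_pow, ← pow_mul, ← pow_add]

theorem qcomp_add {n : ℕ} (hn : Module.finrank Fq F = n) (a b c : Fin n → F) :
    qcomp Fq a (b + c) = qcomp Fq a b + qcomp Fq a c := by
  refine qmap_injective Fq hn (LinearMap.ext fun x => ?_)
  simp only [qmap_qcomp Fq hn, qmap_add, LinearMap.add_apply, map_add]

end QPolyAlgebra

section Coefficients

theorem mul_mod_eq_iff {n s : ℕ} (hs : Nat.gcd s n = 1) {i j : ℕ} :
    s * i % n = s * j % n ↔ i % n = j % n :=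
  ⟨fun h => Nat.ModEq.cancel_left_of_coprime (by rwa [Nat.gcd_comm]) h, fun h =>
    Nat.ModEq.mul_left s h⟩

variable (Fq : Type*) [Fintype Fq] {F : Type*} [Field F]

/-- The coefficient of `x^(q^(si))` in the `q`-polynomial `a`, with `si` taken modulo `n`. -/
def qcoeff {F : Type*} {n : ℕ} [NeZero n] (s : ℕ) (a : Fin n → F) (i : ℕ) : F :=
  a ⟨s * i % n, Nat.mod_lt _ (NeZero.pos n)⟩

variable {n : ℕ} [NeZero n] (s : ℕ)

theorem qcoeff_add (a b : Fin n → F) (i : ℕ) :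
    qcoeff s (a + b) i = qcoeff s a i + qcoeff s b i := rfl

theorem qcoeff_smul (c : F) (a : Fin n → F) (i : ℕ) :
    qcoeff s (c • a) i = c * qcoeff s a i := rfl

theorem qcoeff_add_period {F : Type*} (a : Fin n → F) (i : ℕ) :
    qcoeff s a (i + n) = qcoeff s a i := by
  simp [qcoeff, mul_add]

variable {s} in
theorem qcoeff_qmonomial (hs : Nat.gcd s n = 1) (i j : ℕ) (c : F) :
    qcoeff s (qmonomial n (s * j) c) i = if i % n = j % n then c else 0 := by
  simp only [qcoeff, qmonomial, mul_mod_eq_iff hs]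

variable {s} in
theorem ext_qcoeff {F : Type*} (hs : Nat.gcd s n = 1) {a b : Fin n → F}
    (h : ∀ i < n, qcoeff s a i = qcoeff s b i) : a = b := by
  have hinj : Function.Injective
      (fun i : Fin n => (⟨s * i % n, Nat.mod_lt _ (NeZero.pos n)⟩ : Fin n)) := by
    intro i j hij
    have := (mul_mod_eq_iff hs).1 (Fin.mk.inj_iff.1 hij)
    rwa [Nat.mod_eq_of_lt i.2, Nat.mod_eq_of_lt j.2, ← Fin.ext_iff] at this
  ext j
  obtain ⟨i, rfl⟩ := (Finite.injective_iff_surjective.1 hinj) j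
  exact h i i.2

theorem qpower_apply_add (t : ℕ) (a : Fin n → F) (m : ℕ) :
    qpower Fq t a ⟨(m + t) % n, Nat.mod_lt _ (NeZero.pos n)⟩ =
      a ⟨m % n, Nat.mod_lt _ (NeZero.pos n)⟩ ^ (Fintype.card Fq) ^ t := by
  rw [qpower, Finset.sum_apply, Finset.sum_eq_single ⟨m % n, Nat.mod_lt _ (NeZero.pos n)⟩]
  · simp [qmonomial]
  · intro i _ hi
    rw [qmonomial, if_neg]
    intro h
    have h' : m % n = i % n := Nat.ModEq.add_right_cancel' t h
    rw [Nat.mod_eq_of_lt i.2] at h'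
    exact hi (Fin.ext h'.symm)
  · simp

theorem qcoeff_qpower (a : Fin n → F) (i : ℕ) :
    qcoeff s (qpower Fq s a) (i + 1) = qcoeff s a i ^ (Fintype.card Fq) ^ s :=
  qpower_apply_add Fq s a (s * i)

theorem qcomp_qmonomial_apply_add [Nonempty Fq] (b : Fin n → F) (m t : ℕ) (c : F) :
    qcomp Fq b (qmonomial n t c) ⟨(m + t) % n, Nat.mod_lt _ (NeZero.pos n)⟩ =
      b ⟨m % n, Nat.mod_lt _ (NeZero.pos n)⟩ * c ^ (Fintype.card Fq) ^ (m % n) := by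
  rw [qcomp, Finset.sum_apply, Finset.sum_eq_single ⟨m % n, Nat.mod_lt _ (NeZero.pos n)⟩,
    Finset.sum_apply, Finset.sum_eq_single ⟨t % n, Nat.mod_lt _ (NeZero.pos n)⟩]
  · simp [qmonomial]
  · intro j _ hj
    have hj' : (j : ℕ) ≠ t % n := fun h => hj (Fin.ext h)
    simp [qmonomial, hj', Fintype.card_ne_zero]
  · simp
  · intro i _ hi
    rw [Finset.sum_apply]
    refine Finset.sum_eq_zero fun j _ => ?_
    by_cases hj : (j : ℕ) = t % n
    · rw [qmonomial, if_neg]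
      intro h
      have h1 : (m + t) % n = (i + t) % n := by simpa [hj] using h
      have h' : m % n = i % n := Nat.ModEq.add_right_cancel' t h1
      rw [Nat.mod_eq_of_lt i.2] at h'
      exact hi (Fin.ext h'.symm)
    · simp [qmonomial, hj, Fintype.card_ne_zero]
  · simp

theorem qcoeff_qcomp_qmonomial (Fq : Type*) [Field Fq] [Fintype Fq] [Algebra Fq F] [Finite F]
    (hn : Module.finrank Fq F = n)
    (b : Fin n → F) (i j : ℕ) (c : F) :
    qcoeff s (qcomp Fq b (qmonomial n (s * j) c)) (i + j) =
      qcoeff s b i * c ^ (Fintype.card Fq) ^ (s * i) := by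
  have := qcomp_qmonomial_apply_add Fq b (s * i) (s * j) c
  rw [pow_card_pow_mod Fq hn] at this
  simpa only [qcoeff, mul_add] using this

end Coefficients

section TwistedGabidulin

variable (Fq : Type*) [Field Fq] [Fintype Fq] {F : Type*} [Field F]
variable {n k s : ℕ} {η : F}

theorem qmonomial_mem_twistedGabidulin {i : ℕ} (h1 : 1 ≤ i) (hi : i < k) :
    qmonomial n (s * i) 1 ∈ twistedGabidulin n k s η :=
  Submodule.subset_span (Or.inr ⟨i, h1, hi, rfl⟩)

theorem qmonomial_add_mem_twistedGabidulin :
    qmonomial n 0 1 + qmonomial n (s * k) η ∈ twistedGabidulin n k s η :=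
  Submodule.subset_span (Or.inl rfl)

/-- The elements of `H_{k,s}(η)` are supported on `x^(q^(si))` with `0 ≤ i ≤ k`, and their
coefficients at `i = 0` and `i = k` are proportional. -/
theorem qcoeff_of_mem_twistedGabidulin [NeZero n] (hs : Nat.gcd s n = 1) (hk : 1 ≤ k) (hkn : k < n)
    {f : Fin n → F} (hf : f ∈ twistedGabidulin n k s η) :
    (∀ i, k < i → i < n → qcoeff s f i = 0) ∧ qcoeff s f k = η * qcoeff s f 0 := by
  induction hf using Submodule.span_induction with
  | mem f hf =>
    rcases hf with rfl | ⟨j, h1, hj, rfl⟩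
    · have hz : (qmonomial n 0 1 : Fin n → F) = qmonomial n (s * 0) 1 := rfl
      simp only [hz, qcoeff_add, qcoeff_qmonomial hs]
      refine ⟨fun i hi hin => ?_, ?_⟩
      · rw [Nat.mod_eq_of_lt hin, Nat.mod_eq_of_lt hkn, Nat.zero_mod, if_neg (by omega),
          if_neg (by omega), add_zero]
      · rw [Nat.mod_eq_of_lt hkn, Nat.zero_mod, if_neg (show k ≠ 0 by omega),
          if_neg (show 0 ≠ k by omega)]
        simp
    · simp only [qcoeff_qmonomial hs, Nat.mod_eq_of_lt (hj.trans hkn), Nat.zero_mod]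
      refine ⟨fun i hi hin => ?_, ?_⟩
      · rw [Nat.mod_eq_of_lt hin, if_neg (by omega)]
      · rw [Nat.mod_eq_of_lt hkn, if_neg (by omega), if_neg (by omega), mul_zero]
  | zero => simp [qcoeff]
  | add f g _ _ hf hg =>
    refine ⟨fun i hi hin => ?_, ?_⟩
    · rw [qcoeff_add, hf.1 i hi hin, hg.1 i hi hin, add_zero]
    · rw [qcoeff_add, qcoeff_add, hf.2, hg.2, mul_add]
  | smul c f _ hf =>
    refine ⟨fun i hi hin => ?_, ?_⟩
    · rw [qcoeff_smul, hf.1 i hi hin, mul_zero]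
    · rw [qcoeff_smul, qcoeff_smul, hf.2, mul_left_comm]

theorem qpower_qmonomial_one [Algebra Fq F] [Finite F] (hn : Module.finrank Fq F = n) (t m : ℕ) :
    qpower Fq t (qmonomial n m (1 : F)) = qmonomial n (m + t) 1 := by
  refine qmap_injective Fq hn (LinearMap.ext fun x => ?_)
  rw [qmap_qpower Fq hn, qmap_qmonomial Fq hn, qmap_qmonomial Fq hn, one_mul, one_mul, ← pow_mul,
    ← pow_add]

theorem twistedGabidulin_inf_powerCode [Algebra Fq F] [Finite F] (hn : Module.finrank Fq F = n)
    (hs : Nat.gcd s n = 1) (hk : 2 ≤ k) (hkn : k + 2 ≤ n) (hη : η ≠ 0) :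
    (twistedGabidulin n k s η ⊓ powerCode Fq s (twistedGabidulin n k s η) :
        Submodule F (Fin n → F)) =
      Submodule.span F (Set.range fun i : Fin (k - 2) => qmonomial n (s * (i + 2)) (1 : F)) := by
  have : NeZero n := ⟨by omega⟩
  apply le_antisymm
  · rintro f ⟨hf, a, ha, rfl⟩
    obtain ⟨hf1, hf2⟩ := qcoeff_of_mem_twistedGabidulin hs (by omega) (by omega) hf
    obtain ⟨ha1, ha2⟩ := qcoeff_of_mem_twistedGabidulin hs (by omega) (by omega) ha
    have hq : ∀ t : ℕ, (Fintype.card Fq) ^ t ≠ 0 := fun t => pow_ne_zero _ Fintype.card_ne_zero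
    have h0 : qcoeff s (qpower Fq s a) 0 = 0 := by
      have h := qcoeff_qpower Fq s a (n - 1)
      rw [Nat.sub_add_cancel (by omega), ha1 (n - 1) (by omega) (by omega), zero_pow (hq s)] at h
      rwa [← qcoeff_add_period, zero_add]
    have hak : qcoeff s a k = 0 := by
      have h := hf1 (k + 1) (by omega) (by omega)
      rw [qcoeff_qpower] at h
      exact (pow_eq_zero_iff (hq s)).1 h
    have h1 : qcoeff s (qpower Fq s a) 1 = 0 := by
      rw [hak, eq_comm, mul_eq_zero, or_iff_right hη] at ha2
      rw [← zero_add 1, qcoeff_qpower, ha2, zero_pow (hq s)]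
    rw [h0, mul_zero] at hf2
    have hsum : qpower Fq s a = ∑ j : Fin (k - 2),
        qcoeff s (qpower Fq s a) (j + 2) • qmonomial n (s * (j + 2)) (1 : F) := by
      refine ext_qcoeff hs fun i hi => ?_
      have hexp : qcoeff s (∑ j : Fin (k - 2),
          qcoeff s (qpower Fq s a) (j + 2) • qmonomial n (s * (j + 2)) (1 : F)) i =
          ∑ j : Fin (k - 2), if i = j + 2 then qcoeff s (qpower Fq s a) (j + 2) else 0 := by
        rw [qcoeff, Finset.sum_apply]
        refine Finset.sum_congr rfl fun j _ => ?_
        have := qcoeff_qmonomial hs i (j + 2) (1 : F)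
        rw [Nat.mod_eq_of_lt hi, Nat.mod_eq_of_lt (show (j : ℕ) + 2 < n by omega)] at this
        rw [Pi.smul_apply, smul_eq_mul, ← mul_boole]
        exact congrArg _ this
      rw [hexp]
      by_cases hik : 2 ≤ i ∧ i < k
      · rw [Finset.sum_eq_single ⟨i - 2, by omega⟩]
        · rw [if_pos (show i = i - 2 + 2 by omega)]
          exact congrArg _ (show i = i - 2 + 2 by omega)
        · intro j _ hj
          rw [if_neg]
          rintro rfl
          exact hj (Fin.ext (by simp))
        · simp
      · rw [Finset.sum_eq_zero fun j _ => if_neg (by omega)]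
        rcases (by omega : i = 0 ∨ i = 1 ∨ i = k ∨ k < i) with rfl | rfl | rfl | h
        exacts [h0, h1, hf2, hf1 i h hi]
    rw [hsum]
    exact Submodule.sum_mem _ fun j _ => Submodule.smul_mem _ _ (Submodule.subset_span ⟨j, rfl⟩)
  · rw [Submodule.span_le]
    rintro _ ⟨i, rfl⟩
    exact ⟨qmonomial_mem_twistedGabidulin (by omega) (by omega), qmonomial n (s * (i + 1)) 1,
      qmonomial_mem_twistedGabidulin (by omega) (by omega), qpower_qmonomial_one Fq hn _ _⟩

theorem finrank_twistedGabidulin_inf_powerCode [Algebra Fq F] [Finite F]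
    (hn : Module.finrank Fq F = n) (hs : Nat.gcd s n = 1) (hk : 2 ≤ k) (hkn : k + 2 ≤ n)
    (hη : η ≠ 0) :
    Module.finrank F (twistedGabidulin n k s η ⊓ powerCode Fq s (twistedGabidulin n k s η) :
        Submodule F (Fin n → F)) = k - 2 := by
  have : NeZero n := ⟨by omega⟩
  rw [twistedGabidulin_inf_powerCode Fq hn hs hk hkn hη, finrank_span_eq_card, Fintype.card_fin]
  have hbasis : ∀ m, qmonomial n m (1 : F) =
      Pi.basisFun F (Fin n) ⟨m % n, Nat.mod_lt _ (NeZero.pos n)⟩ := by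
    intro m
    ext j
    simp [qmonomial, Pi.single_apply, Fin.ext_iff]
  simp only [hbasis]
  refine (Pi.basisFun F (Fin n)).linearIndependent.comp
    (fun i : Fin (k - 2) => (⟨s * (i + 2) % n, Nat.mod_lt _ (NeZero.pos n)⟩ : Fin n)) ?_
  intro i j hij
  have := (mul_mod_eq_iff hs).1 (Fin.mk.inj_iff.1 hij)
  rw [Nat.mod_eq_of_lt (by omega), Nat.mod_eq_of_lt (by omega)] at this
  exact Fin.ext (by omega)

theorem norm_eq_one_of_mul_pow_eq_neg_one [Algebra Fq F] [Finite F]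
    (hn : Module.finrank Fq F = 4) (hs : Nat.gcd s 4 = 1)
    (h : η * η ^ (Fintype.card Fq) ^ s = -1) : Algebra.norm Fq η = 1 := by
  have h2 : η ^ (Fintype.card Fq) ^ 2 = η := by
    have hη : η ^ (Fintype.card Fq) ^ s ≠ 0 := by
      intro h0
      rw [h0, mul_zero, eq_comm, neg_eq_zero] at h
      exact one_ne_zero h
    have h' := congrArg ((FiniteField.frobeniusAlgHom Fq F) ^ s) h
    rw [map_mul, map_neg, map_one, frobeniusAlgHom_pow_apply, frobeniusAlgHom_pow_apply,
      ← pow_mul _ _ (_ ^ _), ← pow_add (Fintype.card Fq), ← h, mul_comm η] at h'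
    have h2s := mul_left_cancel₀ hη h'
    rw [← pow_card_pow_mod Fq hn] at h2s
    have : (s + s) % 4 = 2 := by
      have : s % 2 = 1 := by
        rw [← Nat.odd_iff, ← Nat.coprime_two_right]
        exact Nat.Coprime.coprime_dvd_right (by norm_num) hs
      omega
    rwa [this] at h2s
  have h1 : η * η ^ (Fintype.card Fq) = -1 := by
    have hs4 : s % 4 = 1 ∨ s % 4 = 3 := by
      have : s % 2 = 1 := by
        rw [← Nat.odd_iff, ← Nat.coprime_two_right]
        exact Nat.Coprime.coprime_dvd_right (by norm_num) hs
      omega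
    rw [← pow_card_pow_mod Fq hn] at h
    rcases hs4 with h4 | h4 <;> rw [h4] at h
    · rwa [pow_one] at h
    · rwa [pow_succ, pow_mul, h2] at h
  apply (algebraMap Fq F).injective
  rw [FiniteField.algebraMap_norm_eq_prod_pow, hn]
  have h3 : η ^ (Fintype.card Fq) ^ 3 = η ^ (Fintype.card Fq) := by rw [pow_succ, pow_mul, h2]
  simp only [Finset.prod_range_succ, Finset.prod_range_zero, Nat.card_eq_fintype_card, h2, h3,
    pow_zero, pow_one, one_mul, map_one]
  rw [mul_assoc, h1]
  ring

/-- A `q`-polynomial in the left idealiser of `H_{k,s}(η)` is a scalar multiple of `x`. -/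
theorem qcoeff_eq_zero_of_qcomp_mem_twistedGabidulin [Algebra Fq F] [Finite F] [NeZero n]
    (hn : Module.finrank Fq F = n) (hs : Nat.gcd s n = 1) (hk : 2 ≤ k) (hkn : k + 2 ≤ n)
    (hη : η ≠ 0) (hN : Algebra.norm Fq η ≠ (-1) ^ (n * k)) {b : Fin n → F}
    (hb : ∀ f ∈ twistedGabidulin n k s η, qcomp Fq b f ∈ twistedGabidulin n k s η)
    {i : ℕ} (hi0 : 0 < i) (hin : i < n) : qcoeff s b i = 0 := by
  have hmon : ∀ i j, qcoeff s (qcomp Fq b (qmonomial n (s * j) 1)) (i + j) = qcoeff s b i := by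
    intro i j
    rw [qcoeff_qcomp_qmonomial s Fq hn, one_pow, mul_one]
  have hmem := fun j (h1 : 1 ≤ j) (hj : j < k) => qcoeff_of_mem_twistedGabidulin hs (by omega)
    (by omega) (hb _ (qmonomial_mem_twistedGabidulin h1 hj))
  have hmid : ∀ i, 1 < i → i + 1 < n → qcoeff s b i = 0 := by
    intro i h1 hi
    by_cases hik : i < k
    · rw [← hmon i (k + 1 - i)]
      exact (hmem (k + 1 - i) (by omega) (by omega)).1 _ (by omega) (by omega)
    · rw [← hmon i 1]
      exact (hmem 1 (by omega) (by omega)).1 _ (by omega) (by omega)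
  have hprop : ∀ j, 1 ≤ j → j < k → qcoeff s b (k - j) = η * qcoeff s b (n - j) := by
    intro j h1 hj
    have h := (hmem j h1 hj).2
    rw [← qcoeff_add_period s _ 0] at h
    have e1 := hmon (k - j) j
    have e2 := hmon (n - j) j
    rw [Nat.sub_add_cancel (by omega)] at e1 e2
    rwa [zero_add, e1, e2] at h
  have hends : qcoeff s b 1 = 0 ∧ qcoeff s b (n - 1) = 0 := by
    by_cases hk3 : 3 ≤ k
    · constructor
      · have h := hprop (k - 1) (by omega) (by omega)
        rwa [hmid (n - (k - 1)) (by omega) (by omega), mul_zero,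
          show k - (k - 1) = 1 by omega] at h
      · have h := hprop 1 (by omega) (by omega)
        rw [hmid (k - 1) (by omega) (by omega), eq_comm, mul_eq_zero, or_iff_right hη] at h
        exact h
    · obtain rfl : k = 2 := by omega
      have h := hprop 1 le_rfl (by omega)
      have h3 := (qcoeff_of_mem_twistedGabidulin hs (by omega) (by omega)
        (hb _ qmonomial_add_mem_twistedGabidulin)).1 3 (by omega) (by omega)
      have e1 := hmon 3 0
      have e2 := qcoeff_qcomp_qmonomial s Fq hn b 1 2 η
      rw [mul_zero, add_zero] at e1
      rw [qcomp_add Fq hn, qcoeff_add, e1, e2, mul_one] at h3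
      suffices hlast : qcoeff s b (n - 1) = 0 by
        refine ⟨?_, hlast⟩
        rwa [hlast, mul_zero] at h
      have hpow : η ^ (Fintype.card Fq) ^ s ≠ 0 := pow_ne_zero _ hη
      by_cases hn4 : n = 4
      · subst hn4
        norm_num at h ⊢
        rw [h] at h3
        by_contra hne
        refine hN ?_
        rw [norm_eq_one_of_mul_pow_eq_neg_one Fq hn hs]
        · norm_num
        · refine mul_left_cancel₀ hne ?_
          linear_combination h3
      · rw [hmid 3 (by omega) (by omega), zero_add, mul_eq_zero, or_iff_left hpow] at h3
        norm_num at h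
        rw [h3, eq_comm, mul_eq_zero, or_iff_right hη] at h
        exact h
  rcases (by omega : i = 1 ∨ i = n - 1 ∨ (1 < i ∧ i + 1 < n)) with rfl | rfl | h
  exacts [hends.1, hends.2, hmid i h.1 h.2]

end TwistedGabidulin

section CodeEquivalence

/-- An injective additive map `h` of `F` for which every `h (α x)` is a multiple of `h x` by a
factor depending only on `α` is a multiple of a ring endomorphism. -/
theorem exists_ringHom_of_forall_mul {Fq F : Type*} [Field Fq] [Field F]
    [Algebra Fq F] {h : F →ₗ[Fq] F} (hh : Function.Injective h)
    (H : ∀ α, ∃ β, ∀ x, h (α * x) = β * h x) :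
    ∃ (c : F) (ρ : F →+* F), c ≠ 0 ∧ ∀ x, h x = c * ρ x := by
  have hc : h 1 ≠ 0 := fun h0 => one_ne_zero (hh (h0.trans (map_zero h).symm))
  choose β hβ using H
  have hβ1 : ∀ α, h α = β α * h 1 := fun α => by rw [← hβ, mul_one]
  refine ⟨h 1, ⟨⟨⟨β, ?_⟩, ?_⟩, ?_, ?_⟩, hc, fun x => by rw [hβ1 x, mul_comm]; rfl⟩
  · exact mul_right_cancel₀ hc (by rw [← hβ1, one_mul])
  · intro x y
    exact mul_right_cancel₀ hc (by rw [← hβ1, hβ, hβ1 y, mul_assoc])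
  · exact mul_right_cancel₀ hc (by simp [← hβ1])
  · intro x y
    exact mul_right_cancel₀ hc (by simp only [add_mul, ← hβ1, map_add])

variable (Fq : Type*) [Field Fq] [Fintype Fq] {F : Type*} [Field F] [Finite F] [Algebra Fq F]
variable {n : ℕ}

/-- An injective map that carries `C` onto `C'` and commutes with `f ↦ f^{[s]}` up to nonzero
scalars preserves the dimension of the intersection of a code with its power. -/
theorem finrank_inf_powerCode_eq_of_image {s : ℕ} {C C' : Submodule F (Fin n → F)}
    {T : (Fin n → F) → Fin n → F} (hT : Function.Injective T)
    (hTC : (C' : Set (Fin n → F)) = T '' C) {d : F} (hd : d ≠ 0)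
    (hpow : ∀ f, T (qpower Fq s f) = d • qpower Fq s (T f)) :
    Module.finrank F (C ⊓ powerCode Fq s C : Submodule F (Fin n → F)) =
      Module.finrank F (C' ⊓ powerCode Fq s C' : Submodule F (Fin n → F)) := by
  have hpowC : (powerCode Fq s C' : Set (Fin n → F)) = T '' (powerCode Fq s C) := by
    ext f
    constructor
    · intro hf
      obtain ⟨a, ha, hfa⟩ := (powerCode Fq s C').smul_mem d⁻¹ hf
      rw [hTC] at ha
      obtain ⟨a, ha, rfl⟩ := ha
      exact ⟨qpower Fq s a, ⟨a, ha, rfl⟩, by rw [hpow, hfa, smul_inv_smul₀ hd]⟩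
    · rintro ⟨_, ⟨a, ha, rfl⟩, rfl⟩
      rw [hpow]
      refine (powerCode Fq s C').smul_mem d ⟨T a, ?_, rfl⟩
      rw [hTC]
      exact ⟨a, ha, rfl⟩
  have himage : ((C' ⊓ powerCode Fq s C' : Submodule F (Fin n → F)) : Set (Fin n → F)) =
      T '' (C ⊓ powerCode Fq s C : Submodule F (Fin n → F)) := by
    rw [Submodule.coe_inf, Submodule.coe_inf, Set.image_inter hT, hTC, hpowC]
  have hcard := Set.ncard_image_of_injective
    ((C ⊓ powerCode Fq s C : Submodule F (Fin n → F)) : Set (Fin n → F)) hT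
  rw [← himage, ← Nat.card_coe_set_eq, ← Nat.card_coe_set_eq] at hcard
  have h1 := Module.natCard_eq_pow_finrank (K := F)
    (V := (C ⊓ powerCode Fq s C : Submodule F (Fin n → F)))
  have h2 := Module.natCard_eq_pow_finrank (K := F)
    (V := (C' ⊓ powerCode Fq s C' : Submodule F (Fin n → F)))
  exact Nat.pow_right_injective (Finite.one_lt_card (α := F)) (h1.symm.trans (hcard.symm.trans h2))

end CodeEquivalence

/-- If an `F_{q^n}`-linear MRD code `C` of dimension `k`, `2 ≤ k ≤ n - 2`, is equivalent to a
generalized twisted Gabidulin code `H_{k,s}(η)` with `η ≠ 0`, then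
`dim_{F_{q^n}} (C ∩ C^{[s]}) = k - 2`. -/
theorem twisted_gabidulin_necessary_condition
    (Fq F : Type*) [Field Fq] [Fintype Fq] [Field F] [Finite F] [Algebra Fq F]
    (n k s : ℕ) (hn : Module.finrank Fq F = n) (hk : 2 ≤ k) (hkn : k + 2 ≤ n)
    (hs : Nat.gcd s n = 1)
    (η : F) (hη : η ≠ 0) (hN : Algebra.norm Fq η ≠ (-1) ^ (n * k))
    (C : Submodule F (Fin n → F)) (hC : IsLinearMRD Fq k C)
    (hequiv : CodeEquiv Fq (C : Set (Fin n → F)) (twistedGabidulin n k s η : Set (Fin n → F))) :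
    Module.finrank F (C ⊓ powerCode Fq s C : Submodule F (Fin n → F)) = k - 2 := by
  have : NeZero n := ⟨by omega⟩
  obtain ⟨h, g, σ, hh, hg, hH⟩ := hequiv
  have hqmap : ∀ f x, qmap Fq (qcomp Fq h (qcomp Fq (fun i => σ (f i)) g)) x =
      qmap Fq h (σ (qmap Fq f (σ.symm (qmap Fq g x)))) := fun f x => by
    rw [qmap_qcomp Fq hn, qmap_qcomp Fq hn, qmap_map_apply]
  obtain ⟨c, ρ, hc, hρ⟩ : ∃ (c : F) (ρ : F →+* F), c ≠ 0 ∧ ∀ x, qmap Fq h x = c * ρ x := by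
    refine exists_ringHom_of_forall_mul hh.1 fun α => ?_
    let e := LinearEquiv.ofBijective (qmap Fq h) hh
    obtain ⟨b, hb⟩ := (qmap_bijective Fq hn).2
      ((qmap Fq h ∘ₗ LinearMap.mulLeft Fq α) ∘ₗ e.symm.toLinearMap)
    have hbh : ∀ x, qmap Fq b (qmap Fq h x) = qmap Fq h (α * x) := by
      intro x
      rw [hb]
      have : e.symm (qmap Fq h x) = x := e.symm_apply_apply x
      simp [this]
    have hstab : ∀ f ∈ twistedGabidulin n k s η, qcomp Fq b f ∈ twistedGabidulin n k s η := by
      intro f hf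
      rw [← SetLike.mem_coe, hH] at hf ⊢
      obtain ⟨a, ha, rfl⟩ := hf
      refine ⟨σ.symm α • a, C.smul_mem _ ha, qmap_injective Fq hn (LinearMap.ext fun x => ?_)⟩
      rw [hqmap, qmap_qcomp Fq hn, hqmap, hbh, qmap_smul_apply, map_mul, σ.apply_symm_apply]
    have hbmon : b = qmonomial n 0 (qcoeff s b 0) := by
      refine ext_qcoeff hs fun i hi => ?_
      have hcoeff := qcoeff_qmonomial hs i 0 (qcoeff s b 0)
      rw [mul_zero, Nat.zero_mod, Nat.mod_eq_of_lt hi] at hcoeff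
      rw [hcoeff]
      split_ifs with h0
      · rw [h0]
      · exact qcoeff_eq_zero_of_qcomp_mem_twistedGabidulin Fq hn hs hk hkn hη hN hstab
          (Nat.pos_of_ne_zero h0) hi
    refine ⟨qcoeff s b 0, fun x => ?_⟩
    rw [← hbh, hbmon, qmap_qmonomial Fq hn, pow_zero, pow_one, ← hbmon]
  have hcs : c ^ (Fintype.card Fq) ^ s ≠ 0 := pow_ne_zero _ hc
  rw [finrank_inf_powerCode_eq_of_image Fq (s := s) (C' := twistedGabidulin n k s η)
    (d := c / c ^ (Fintype.card Fq) ^ s) ?_ hH (div_ne_zero hc hcs) ?_,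
    finrank_twistedGabidulin_inf_powerCode Fq hn hs hk hkn hη]
  · intro a b hab
    refine qmap_injective Fq hn (LinearMap.ext fun x => ?_)
    obtain ⟨y, hy⟩ := hg.2 (σ x)
    have hxy := LinearMap.congr_fun (congrArg (qmap Fq) hab) y
    rw [hqmap, hqmap, hy, σ.symm_apply_apply] at hxy
    exact σ.injective (hh.1 hxy)
  · intro f
    refine qmap_injective Fq hn (LinearMap.ext fun x => ?_)
    rw [hqmap, qmap_smul_apply, qmap_qpower Fq hn, qmap_qpower Fq hn, hqmap, hρ, hρ, map_pow,
      map_pow, mul_pow, ← mul_assoc, div_mul_cancel₀ _ hcs]
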